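/- arXiv:1603.03956 — 6 statements merged into one kernel-verified Lean document; each statement's English description precedes it below -/
import Mathlib

section
/- Consider the Naive-FSIG with N users and K = N channels, with fixed channel gains g_{m,n,k} > 0, powers P_n > 0 and noise power N_0 > 0. If for every user n it holds that (1/N_0)·min_k g_{n,k} > max_l [ g_{n,l} / (N_0 + min_{m ≠ n} g_{m,n,l} P_m) ], then a strategy profile a is a pure Nash equilibrium of the Naive-FSIG if and only if a : {1,…,N} → {1,…,N} is a bijection; consequently the Naive-FSIG has exactly N! pure Nash equilibria. -/
open MeasureTheory ProbabilityTheory Filter Finset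

/-- `orderStat Y i` is the i-th smallest value (1-indexed) among `Y 0, …, Y (N-1)`. -/
noncomputable def orderStat {N : ℕ} (Y : Fin N → ℝ) (i : ℕ) : ℝ :=
  ((List.ofFn Y).mergeSort (· ≤ ·)).getD (i - 1) 0

/-- Interference experienced by user `n` on channel `k` under profile `a`. -/
noncomputable def interf {N : ℕ} (g : Fin N → Fin N → Fin N → ℝ) (P : Fin N → ℝ)
    (n k : Fin N) (a : Fin N → Fin N) : ℝ :=
  ∑ m ∈ Finset.univ.filter (fun m => m ≠ n ∧ a m = k), g m n k * P m

/-- Utility of user `n` in the Naive-FSIG. -/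
noncomputable def naiveU {N : ℕ} (g : Fin N → Fin N → Fin N → ℝ) (P : Fin N → ℝ) (N0 : ℝ)
    (n : Fin N) (a : Fin N → Fin N) : ℝ :=
  Real.logb 2 (1 + P n * g n n (a n) / (N0 + interf g P n (a n) a))

/-- Pure Nash equilibrium of the Naive-FSIG. -/
def isNaivePNE {N : ℕ} (g : Fin N → Fin N → Fin N → ℝ) (P : Fin N → ℝ) (N0 : ℝ)
    (a : Fin N → Fin N) : Prop :=
  ∀ n b, naiveU g P N0 n (Function.update a n b) ≤ naiveU g P N0 n a

section Game

variable {N : ℕ} {g : Fin N → Fin N → Fin N → ℝ} {P : Fin N → ℝ} {N0 : ℝ}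

lemma interf_update (n k b : Fin N) (a : Fin N → Fin N) :
    interf g P n k (Function.update a n b) = interf g P n k a := by
  unfold interf
  congr 1
  ext m
  simp only [Finset.mem_filter, Finset.mem_univ, true_and]
  refine and_congr_right fun h => ?_
  rw [Function.update_of_ne h]

lemma interf_nonneg (hg : ∀ m n k, 0 < g m n k) (hP : ∀ n, 0 < P n)
    (n k : Fin N) (a : Fin N → Fin N) : 0 ≤ interf g P n k a :=
  Finset.sum_nonneg fun m _ => (mul_pos (hg m n k) (hP m)).le

lemma le_interf (hg : ∀ m n k, 0 < g m n k) (hP : ∀ n, 0 < P n)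
    {m n : Fin N} (hmn : m ≠ n) (a : Fin N → Fin N) :
    g m n (a m) * P m ≤ interf g P n (a m) a :=
  Finset.single_le_sum (f := fun i => g i n (a m) * P i)
    (fun i _ => (mul_pos (hg i n (a m)) (hP i)).le) (by simp [hmn])

lemma interf_eq_zero {n k : Fin N} {a : Fin N → Fin N} (h : ∀ m ≠ n, a m ≠ k) :
    interf g P n k a = 0 := by
  unfold interf
  rw [Finset.filter_false_of_mem, Finset.sum_empty]
  rintro m - ⟨hm, hk⟩
  exact h m hm hk

lemma naiveU_update_le_iff (hg : ∀ m n k, 0 < g m n k) (hP : ∀ n, 0 < P n) (hN0 : 0 < N0)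
    (n b : Fin N) (a : Fin N → Fin N) :
    naiveU g P N0 n (Function.update a n b) ≤ naiveU g P N0 n a ↔
      g n n b / (N0 + interf g P n b a) ≤ g n n (a n) / (N0 + interf g P n (a n) a) := by
  have pos (k : Fin N) : 0 < 1 + P n * g n n k / (N0 + interf g P n k a) := by
    have := interf_nonneg hg hP n k a
    have := hg n n k
    have := hP n
    positivity
  unfold naiveU
  rw [Function.update_self, interf_update, Real.logb_le_logb one_lt_two (pos b) (pos (a n)),
    add_le_add_iff_left, mul_div_assoc, mul_div_assoc, mul_le_mul_iff_right₀ (hP n)]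

/-- A shared channel is worse than any empty channel. -/
lemma shared_lt_empty (hg : ∀ m n k, 0 < g m n k) (hP : ∀ n, 0 < P n) (hN0 : 0 < N0)
    (hcond : ∀ n l k, ∀ m ≠ n, g n n l / (N0 + g m n l * P m) < g n n k / N0)
    {m n k : Fin N} (hmn : m ≠ n) {a : Fin N → Fin N} (hk : ∀ i ≠ n, a i ≠ k) :
    g n n (a m) / (N0 + interf g P n (a m) a) < g n n k / (N0 + interf g P n k a) := by
  rw [interf_eq_zero hk, add_zero]
  refine lt_of_le_of_lt ?_ (hcond n (a m) k m hmn)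
  have := mul_pos (hg m n (a m)) (hP m)
  exact div_le_div_of_nonneg_left (hg n n (a m)).le (by positivity)
    (add_le_add_right (le_interf hg hP hmn a) N0)

theorem isNaivePNE_iff_bijective (hg : ∀ m n k, 0 < g m n k) (hP : ∀ n, 0 < P n)
    (hN0 : 0 < N0)
    (hcond : ∀ n l k, ∀ m ≠ n, g n n l / (N0 + g m n l * P m) < g n n k / N0)
    (a : Fin N → Fin N) : isNaivePNE g P N0 a ↔ Function.Bijective a := by
  simp only [isNaivePNE, naiveU_update_le_iff hg hP hN0]
  constructor
  · intro h
    rw [← Finite.injective_iff_bijective]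
    by_contra hinj
    have hsurj : ¬ Function.Surjective a := fun hs => hinj (Finite.injective_iff_surjective.2 hs)
    simp only [Function.Injective, not_forall] at hinj
    simp only [Function.Surjective, not_forall, not_exists] at hsurj
    obtain ⟨m, n, hmn, hne⟩ := hinj
    obtain ⟨k, hk⟩ := hsurj
    have hlt := shared_lt_empty hg hP hN0 hcond hne (a := a) fun i _ => hk i
    rw [hmn] at hlt
    exact (h n k).not_gt hlt
  · intro ha n b
    obtain ⟨m, rfl⟩ := ha.surjective b
    obtain rfl | hmn := eq_or_ne m n
    · exact le_rfl
    · exact (shared_lt_empty hg hP hN0 hcond hmn fun i hi => ha.injective.ne hi).le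

end Game

theorem stmt0 {N : ℕ} (g : Fin N → Fin N → Fin N → ℝ) (P : Fin N → ℝ) (N0 : ℝ)
    (hg : ∀ m n k, 0 < g m n k) (hP : ∀ n, 0 < P n) (hN0 : 0 < N0)
    (hcond : ∀ n l k, ∀ m ≠ n, g n n l / (N0 + g m n l * P m) < g n n k / N0) :
    (∀ a : Fin N → Fin N, isNaivePNE g P N0 a ↔ Function.Bijective a) ∧
      Nat.card {a : Fin N → Fin N // isNaivePNE g P N0 a} = N.factorial := by
  have hiff := isNaivePNE_iff_bijective hg hP hN0 hcond
  refine ⟨hiff, ?_⟩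
  rw [Nat.card_congr ((Equiv.subtypeEquivRight hiff).trans Equiv.bijectiveEquiv), Nat.card_perm,
    Nat.card_fin]
end

section
/- Let p ∈ (0,1) be fixed, let S_N be a binomial random variable with parameters N and p, and let (M_N) be a sequence of natural numbers with lim_{N→∞} M_N/N = 0. Then there exists N_1 such that for all N ≥ N_1, P(S_N ≤ M_N) ≤ (1 + p)^{-N}. -/
open MeasureTheory ProbabilityTheory Filter

/-- Chernoff bound for the lower tail of the binomial distribution. -/
theorem pow_mul_binomial_lower_tail_le {p t : ℝ} (hp0 : 0 ≤ p) (hp1 : p ≤ 1) (ht0 : 0 ≤ t)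
    (ht1 : t ≤ 1) (N m : ℕ) :
    t ^ m * ∑ k ∈ (Finset.range (N + 1)).filter (· ≤ m),
      (N.choose k * p ^ k * (1 - p) ^ (N - k) : ℝ) ≤ (t * p + (1 - p)) ^ N := by
  have hq : 0 ≤ 1 - p := sub_nonneg.2 hp1
  rw [add_pow, Finset.mul_sum]
  calc
    _ ≤ ∑ k ∈ (Finset.range (N + 1)).filter (· ≤ m),
          (t * p) ^ k * (1 - p) ^ (N - k) * (N.choose k : ℝ) := by
      refine Finset.sum_le_sum fun k hk => ?_
      have hkm : t ^ m ≤ t ^ k := pow_le_pow_of_le_one ht0 ht1 (Finset.mem_filter.1 hk).2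
      calc
        _ ≤ t ^ k * (N.choose k * p ^ k * (1 - p) ^ (N - k) : ℝ) := by gcongr
        _ = _ := by rw [mul_pow]; ring
    _ ≤ _ := Finset.sum_le_sum_of_subset_of_nonneg (Finset.filter_subset _ _)
      fun k _ _ => by positivity

/-- If `m N / N → 0` and `r < 1`, then `r ^ N` is eventually at most `t ^ m N`. -/
theorem eventually_pow_le_pow_of_tendsto_div_zero {r t : ℝ} (hr0 : 0 ≤ r) (hr1 : r < 1)
    (ht : 0 < t) {m : ℕ → ℕ} (hm : Tendsto (fun N => (m N : ℝ) / N) atTop (nhds 0)) :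
    ∀ᶠ N in atTop, r ^ N ≤ t ^ m N := by
  obtain ⟨a, ha⟩ := exists_pow_lt_of_lt_one ht hr1
  have hpos : (0 : ℝ) < 1 / (a + 1) := by positivity
  filter_upwards [hm.eventually (gt_mem_nhds hpos), eventually_gt_atTop 0] with N hN hN0
  have hN0' : (0 : ℝ) < N := by exact_mod_cast hN0
  rw [div_lt_div_iff₀ hN0' (by positivity), one_mul] at hN
  have hmul : m N * (a + 1) < N := by exact_mod_cast hN
  calc
    r ^ N ≤ r ^ (a * m N) := pow_le_pow_of_le_one hr0 hr1.le (by nlinarith)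
    _ = (r ^ a) ^ m N := pow_mul _ _ _
    _ ≤ t ^ m N := by gcongr

/-- For `S N ~ Binomial(N, p)` with fixed `p ∈ (0,1)` and `M N / N → 0`, there is `N₁`
such that for all `N ≥ N₁`, `P(S N ≤ M N) ≤ (1 + p)⁻ᴺ`. -/
theorem stmt2
    (Ω : Type) [MeasurableSpace Ω] (Pr : Measure Ω) [IsProbabilityMeasure Pr]
    (p : ℝ) (hp : p ∈ Set.Ioo (0 : ℝ) 1)
    (S : ℕ → Ω → ℕ)
    (hS : ∀ N k : ℕ, k ≤ N →
      Pr {ω | S N ω = k} = ENNReal.ofReal (N.choose k * p ^ k * (1 - p) ^ (N - k)))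
    (hSle : ∀ N ω, S N ω ≤ N)
    (M : ℕ → ℕ) (hM : Tendsto (fun N => (M N : ℝ) / N) atTop (nhds 0)) :
    ∃ N₁ : ℕ, ∀ N ≥ N₁, Pr {ω | S N ω ≤ M N} ≤ ENNReal.ofReal (((1 + p) ^ N)⁻¹) := by
  obtain ⟨hp0, hp1⟩ := hp
  have hq : 0 < 1 - p := sub_pos.2 hp1
  have ht : 0 < p / 4 := by positivity
  have hr0 : 0 ≤ (1 + p) * (p / 4 * p + (1 - p)) := by positivity
  have hr1 : (1 + p) * (p / 4 * p + (1 - p)) < 1 := by nlinarith [mul_pos hp0 hp0]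
  refine eventually_atTop.1 ?_
  filter_upwards [eventually_pow_le_pow_of_tendsto_div_zero hr0 hr1 ht hM] with N hN
  have hsub : {ω | S N ω ≤ M N} ⊆
      ⋃ k ∈ (Finset.range (N + 1)).filter (· ≤ M N), {ω | S N ω = k} := by
    intro ω hω
    simpa [Nat.lt_succ_iff] using And.intro (hSle N ω) hω
  calc
    _ ≤ ∑ k ∈ (Finset.range (N + 1)).filter (· ≤ M N), Pr {ω | S N ω = k} :=
      (measure_mono hsub).trans (measure_biUnion_finset_le _ _)
    _ = ∑ k ∈ (Finset.range (N + 1)).filter (· ≤ M N),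
          ENNReal.ofReal (N.choose k * p ^ k * (1 - p) ^ (N - k)) :=
      Finset.sum_congr rfl fun k hk =>
        hS N k (Nat.lt_succ_iff.1 (Finset.mem_range.1 (Finset.mem_filter.1 hk).1))
    _ = ENNReal.ofReal (∑ k ∈ (Finset.range (N + 1)).filter (· ≤ M N),
          (N.choose k * p ^ k * (1 - p) ^ (N - k) : ℝ)) :=
      (ENNReal.ofReal_sum_of_nonneg fun k _ => by positivity).symm
    _ ≤ _ := by
      refine ENNReal.ofReal_le_ofReal ?_
      have hc := pow_mul_binomial_lower_tail_le hp0.le hp1.le ht.le (by linarith) N (M N)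
      rw [← one_div, le_div_iff₀ (by positivity)]
      refine le_of_mul_le_mul_left ?_ (pow_pos ht (M N))
      rw [mul_one, ← mul_assoc]
      refine le_trans ?_ hN
      rw [mul_pow, mul_comm ((1 + p) ^ N)]
      gcongr
end

section
/- Let ε > 0 and let (M_N) be a sequence of real numbers with (1+ε)·ln N ≤ M_N ≤ N for all N. Then N·(1 − M_N/N)^N + N·M_N·(1 − M_N/N)^{N−1} → 0 as N → ∞. -/
open Filter

theorem tendsto_one_add_mul_exp_neg_mul_atTop {c : ℝ} (hc : 0 < c) :
    Tendsto (fun x : ℝ => (1 + x) * Real.exp (-c * x)) atTop (nhds 0) := by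
  have h0 := tendsto_rpow_mul_exp_neg_mul_atTop_nhds_zero 0 c hc
  have h1 := tendsto_rpow_mul_exp_neg_mul_atTop_nhds_zero 1 c hc
  simpa [add_mul] using h0.add h1

theorem one_sub_div_pow_pred_le {N : ℕ} (hN : 0 < N) {m : ℝ} (hm : m ≤ N) :
    (1 - m / N) ^ (N - 1) ≤ Real.exp 1 * Real.exp (-m) := by
  have hN' : (0 : ℝ) < N := by exact_mod_cast hN
  have hx : m / N ≤ 1 := (div_le_one hN').2 hm
  calc (1 - m / N) ^ (N - 1) ≤ Real.exp (-(m / N)) ^ (N - 1) :=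
        pow_le_pow_left₀ (by linarith) (Real.one_sub_le_exp_neg _) _
    _ = Real.exp (m / N + -m) := by
        rw [← Real.exp_nat_mul, Nat.cast_pred hN]
        congr 1
        field_simp
        ring
    _ ≤ Real.exp 1 * Real.exp (-m) := by
        rw [← Real.exp_add]
        gcongr

/-- If `(1+ε) ln N ≤ M N ≤ N` for a fixed `ε > 0`, then
`N (1 − M N / N)^N + N M N (1 − M N / N)^(N−1) → 0` as `N → ∞`. -/
theorem stmt7
    (ε : ℝ) (hε : 0 < ε)
    (M : ℕ → ℝ) (hM : ∀ N : ℕ, (1 + ε) * Real.log N ≤ M N ∧ M N ≤ N) :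
    Tendsto
      (fun N : ℕ =>
        N * (1 - M N / N) ^ N + N * M N * (1 - M N / N) ^ (N - 1))
      atTop (nhds 0) := by
  have hlog : Tendsto (fun N : ℕ => (1 + ε) * Real.log N) atTop atTop :=
    (Real.tendsto_log_atTop.comp tendsto_natCast_atTop_atTop).const_mul_atTop (by linarith)
  have hMtop : Tendsto M atTop atTop := tendsto_atTop_mono (fun N => (hM N).1) hlog
  have hc : 0 < ε / (1 + ε) := by positivity
  have hbound := ((tendsto_one_add_mul_exp_neg_mul_atTop hc).comp hMtop).const_mul (Real.exp 1)
  rw [mul_zero] at hbound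
  have hfacts : ∀ N : ℕ, 0 < N → 0 ≤ M N ∧ 0 ≤ 1 - M N / N := by
    intro N hN
    have hN' : (0 : ℝ) < N := by exact_mod_cast hN
    have hM0 : 0 ≤ M N :=
      (mul_nonneg (by linarith) (Real.log_natCast_nonneg N)).trans (hM N).1
    exact ⟨hM0, sub_nonneg.2 ((div_le_one hN').2 (hM N).2)⟩
  refine squeeze_zero' ?_ ?_ hbound
  · filter_upwards [eventually_gt_atTop 0] with N hN
    obtain ⟨hM0, hx⟩ := hfacts N hN
    positivity
  · filter_upwards [eventually_gt_atTop 0] with N hN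
    obtain ⟨hM0, hx⟩ := hfacts N hN
    have hN' : (0 : ℝ) < N := by exact_mod_cast hN
    have hx1 : 1 - M N / N ≤ 1 := sub_le_self _ (by positivity)
    have hNexp : (N : ℝ) ≤ Real.exp (M N / (1 + ε)) := by
      rw [← Real.log_le_iff_le_exp hN', le_div_iff₀ (by linarith), mul_comm]
      exact (hM N).1
    calc N * (1 - M N / N) ^ N + N * M N * (1 - M N / N) ^ (N - 1)
        ≤ N * (1 - M N / N) ^ (N - 1) + N * M N * (1 - M N / N) ^ (N - 1) := by
          gcongr ?_ + _
          exact mul_le_mul_of_nonneg_left (pow_le_pow_of_le_one hx hx1 (Nat.sub_le N 1)) hN'.le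
      _ = N * (1 + M N) * (1 - M N / N) ^ (N - 1) := by ring
      _ ≤ Real.exp (M N / (1 + ε)) * (1 + M N) * (Real.exp 1 * Real.exp (-M N)) := by
          gcongr
          exact one_sub_div_pow_pred_le hN (hM N).2
      _ = Real.exp 1 * ((1 + M N) * (Real.exp (M N / (1 + ε)) * Real.exp (-M N))) := by ring
      _ = Real.exp 1 * ((1 + M N) * Real.exp (-(ε / (1 + ε)) * M N)) := by
          rw [← Real.exp_add]
          congr 3
          field_simp
          ring
end

section
/- Let A_1, A_2, …, A_N be finite sets and let M < N be a positive integer with |A_n| ≥ M for all n = 1,…,N. If there exists a system of distinct representatives for (A_1,…,A_N), i.e., an injective map f with f(n) ∈ A_n for every n, then the number of such systems of distinct representatives (injective maps f with f(n) ∈ A_n for all n) is at least M!. -/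
/-- Systems of distinct representatives of a family of finite sets. -/
abbrev DistinctReps {ι α : Type*} (A : ι → Finset α) : Type _ :=
  {f : ι → α // Function.Injective f ∧ ∀ n, f n ∈ A n}

instance DistinctReps.instFinite {ι α : Type*} [Finite ι] (A : ι → Finset α) :
    Finite (DistinctReps A) :=
  Finite.of_injective (fun f (i : ι) => (⟨f.1 i, f.2.2 i⟩ : A i)) fun _ _ h =>
    Subtype.ext <| funext fun i => congrArg Subtype.val (congrFun h i)

/-- A system of distinct representatives on a critical subfamily extends to the whole family,
by means of any system of the whole family. -/
theorem card_distinctReps_restrict_le {ι α : Type*} [Finite ι] [DecidableEq α]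
    (A : ι → Finset α) (f : DistinctReps A) (S : Finset ι)
    (hS : (S.biUnion A).card = S.card) :
    Nat.card (DistinctReps fun j : S => A j) ≤ Nat.card (DistinctReps A) := by
  classical
  have himage : S.image f.1 = S.biUnion A := by
    refine Finset.eq_of_subset_of_card_le (fun x hx => ?_) ?_
    · obtain ⟨i, hi, rfl⟩ := Finset.mem_image.1 hx
      exact Finset.mem_biUnion.2 ⟨i, hi, f.2.2 i⟩
    · rw [hS, Finset.card_image_of_injective _ f.2.1]
  have hne (g : DistinctReps fun j : S => A j) (i : S) (j : ι) (hj : j ∉ S) :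
      g.1 i ≠ f.1 j := by
    intro h
    have hmem : g.1 i ∈ S.image f.1 :=
      himage ▸ Finset.mem_biUnion.2 ⟨i, i.2, g.2.2 i⟩
    obtain ⟨k, hk, hkj⟩ := Finset.mem_image.1 hmem
    exact hj (f.2.1 (hkj.trans h) ▸ hk)
  refine Nat.card_le_card_of_injective
    (fun g => ⟨fun i => if h : i ∈ S then g.1 ⟨i, h⟩ else f.1 i, ?_, fun i => ?_⟩) ?_
  · intro i j hij
    by_cases hi : i ∈ S <;> by_cases hj : j ∈ S <;>
      simp only [hi, hj, dite_true, dite_false] at hij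
    · exact congrArg Subtype.val (g.2.1 hij)
    · exact (hne g _ j hj hij).elim
    · exact (hne g _ i hi hij.symm).elim
    · exact f.2.1 hij
  · by_cases hi : i ∈ S
    · simpa [hi] using g.2.2 ⟨i, hi⟩
    · simpa [hi] using f.2.2 i
  · intro g g' h
    ext i
    simpa using congrFun (congrArg Subtype.val h) i

/-- Fixing the representative of one set. -/
theorem sum_card_distinctReps_erase_le {ι α : Type*} [Finite ι] [DecidableEq α]
    (A : ι → Finset α) (i : ι) :
    ∑ a : A i, Nat.card (DistinctReps fun j : {j // j ≠ i} => (A j).erase a) ≤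
      Nat.card (DistinctReps A) := by
  classical
  rw [← Nat.card_sigma]
  refine Nat.card_le_card_of_injective
    (fun p => ⟨fun j => if h : j = i then p.1 else p.2.1 ⟨j, h⟩, ?_, fun j => ?_⟩) ?_
  · intro j k hjk
    by_cases hj : j = i <;> by_cases hk : k = i <;> simp only [hj, hk, dite_true, dite_false] at hjk
    · rw [hj, hk]
    · exact (Finset.ne_of_mem_erase (p.2.2.2 ⟨k, hk⟩) hjk.symm).elim
    · exact (Finset.ne_of_mem_erase (p.2.2.2 ⟨j, hj⟩) hjk).elim
    · exact congrArg Subtype.val (p.2.2.1 hjk)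
  · by_cases hj : j = i
    · subst hj
      simp
    · simpa [hj] using Finset.mem_of_mem_erase (p.2.2.2 ⟨j, hj⟩)
  · rintro ⟨a, g⟩ ⟨b, g'⟩ h
    have h' := congrFun (congrArg Subtype.val h)
    obtain rfl : a = b := Subtype.ext (by simpa using h' i)
    congr 1
    ext j
    simpa [j.2] using h' j

/-- Marshall Hall's bound for a family indexed by any finite type. -/
theorem factorial_le_card_distinctReps {α : Type*} (M : ℕ) {ι : Type*} [Finite ι]
    (hM : M ≤ Nat.card ι) (A : ι → Finset α) (hA : ∀ n, M ≤ (A n).card)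
    (hex : Nonempty (DistinctReps A)) : M.factorial ≤ Nat.card (DistinctReps A) := by
  classical
  induction hn : Nat.card ι using Nat.strong_induction_on generalizing M ι with
  | _ n ih =>
  subst hn
  have := Fintype.ofFinite ι
  obtain ⟨f⟩ := hex
  rcases M with _ | M
  · exact Nat.card_pos_iff.2 ⟨⟨f⟩, inferInstance⟩
  have hhall (S : Finset ι) : S.card ≤ (S.biUnion A).card :=
    (Finset.all_card_le_biUnion_card_iff_existsInjective' A).2 ⟨f.1, f.2⟩ S
  by_cases hcrit : ∃ S : Finset ι, S.Nonempty ∧ S ≠ Finset.univ ∧ (S.biUnion A).card = S.card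
  · obtain ⟨S, ⟨i, hi⟩, hproper, hS⟩ := hcrit
    have hMS : M + 1 ≤ S.card :=
      (hA i).trans (hS ▸ Finset.card_le_card (Finset.subset_biUnion_of_mem A hi))
    refine le_trans ?_ (card_distinctReps_restrict_le A f S hS)
    refine ih (Nat.card S) ?_ (M + 1) (by simpa using hMS) _ (fun j => hA j)
      ⟨⟨fun j => f.1 j, f.2.1.comp Subtype.val_injective, fun j => f.2.2 j⟩⟩ rfl
    simpa using (Finset.card_lt_iff_ne_univ S).2 hproper
  · have hstrict (S : Finset ι) (hne : S.Nonempty) (hproper : S ≠ Finset.univ) :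
        S.card < (S.biUnion A).card :=
      (hhall S).lt_of_ne fun h => hcrit ⟨S, hne, hproper, h.symm⟩
    obtain ⟨i⟩ : Nonempty ι := (Nat.card_pos_iff.1 (by omega)).1
    have hcard : Nat.card {j // j ≠ i} = Nat.card ι - 1 := by simp
    refine le_trans ?_ (sum_card_distinctReps_erase_le A i)
    calc
      (M + 1).factorial ≤ (A i).card * M.factorial := Nat.mul_le_mul_right _ (hA i)
      _ = ∑ _a : A i, M.factorial := by simp
      _ ≤ _ := Finset.sum_le_sum fun a _ => ?_
    refine ih (Nat.card {j // j ≠ i}) (by omega) M (by omega) _ (fun j => ?_) ?_ rfl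
    · have := Finset.pred_card_le_card_erase (s := A j) (a := (a : α))
      have := hA j
      omega
    · obtain ⟨g, hg⟩ := (Finset.all_card_le_biUnion_card_iff_existsInjective' _).1
        (HallMarriageTheorem.hall_cond_of_erase (a : α) hstrict)
      exact ⟨g, hg⟩

/-- Marshall Hall Jr.'s theorem: if finite sets `A 0, …, A (N-1)` each have at least `M`
elements, `M < N`, and a system of distinct representatives exists, then there are at
least `M!` systems of distinct representatives. -/
theorem stmt9 {α : Type} {N M : ℕ} (hM : 0 < M) (hMN : M < N)
    (A : Fin N → Finset α) (hA : ∀ n, M ≤ (A n).card)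
    (hex : ∃ f : Fin N → α, Function.Injective f ∧ ∀ n, f n ∈ A n) :
    M.factorial ≤ Nat.card {f : Fin N → α // Function.Injective f ∧ ∀ n, f n ∈ A n} :=
  factorial_le_card_distinctReps M (by simpa using hMN.le) A hA (nonempty_subtype.2 hex)
end

section
/- Consider a finite normal-form game with players n = 1,…,N, finite strategy sets A_n, and utilities u_n. Let 0 < α ≤ 1 be constant and let sequences (a(t))_{t ≥ 0} of strategy profiles and (Ū_{n,k}(t))_{t ≥ 0} of fictitious utilities evolve by the Modified Fictitious Play dynamics: Ū_{n,k}(t) = (1−α)·Ū_{n,k}(t−1) + α·u_n(k, a_{-n}(t)) for all k ∈ A_n, and a_n(t+1) maximizes k ↦ Ū_{n,k}(t) over A_n, with ties broken so that a_n(t+1) = a_n(t) whenever a_n(t) is a maximizer of Ū_{n,·}(t). If at some time t_0 the profile a(t_0) is a pure Nash equilibrium and a_n(t_0) maximizes Ū_{n,·}(t_0 − 1) for every n, then a(t) = a(t_0) for all t > t_0. -/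
open Filter

/-- Modified Fictitious Play with constant step `α`: if at time `t₀` the played profile
`a t₀` is a pure Nash equilibrium and, for every player `n`, `a t₀ n` maximizes the
fictitious utility `Ū (t₀ − 1) n ·`, then `a t = a t₀` for all `t > t₀`. -/
theorem stmt18
    {N : ℕ} (A : Fin N → Type) [∀ n, Fintype (A n)] [∀ n, Nonempty (A n)]
    (u : (n : Fin N) → ((m : Fin N) → A m) → ℝ)
    (α : ℝ) (hα0 : 0 < α) (hα1 : α ≤ 1)
    (a : ℕ → (m : Fin N) → A m) (U : ℕ → (n : Fin N) → A n → ℝ)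
    (hupdate : ∀ (t : ℕ) (n : Fin N) (k : A n),
      U (t + 1) n k = (1 - α) * U t n k + α * u n (Function.update (a (t + 1)) n k))
    (hbr : ∀ (t : ℕ) (n : Fin N) (k : A n), U t n k ≤ U t n (a (t + 1) n))
    (htie : ∀ (t : ℕ) (n : Fin N),
      (∀ k : A n, U t n k ≤ U t n (a t n)) → a (t + 1) n = a t n)
    (t₀ : ℕ)
    (hPNE : ∀ (n : Fin N) (k : A n), u n (Function.update (a t₀) n k) ≤ u n (a t₀))
    (hmax : ∀ (n : Fin N) (k : A n), U (t₀ - 1) n k ≤ U (t₀ - 1) n (a t₀ n)) :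
    ∀ t : ℕ, t₀ < t → a t = a t₀ := by
  have step : ∀ s : ℕ, a (s + 1) = a t₀ → (∀ n k, U s n k ≤ U s n (a t₀ n)) →
      ∀ n k, U (s + 1) n k ≤ U (s + 1) n (a t₀ n) := by
    intro s hs hU n k
    rw [hupdate, hupdate, hs, Function.update_eq_self]
    exact add_le_add (mul_le_mul_of_nonneg_left (hU n k) (sub_nonneg.2 hα1))
      (mul_le_mul_of_nonneg_left (hPNE n k) hα0.le)
  have invariant : ∀ t, t₀ ≤ t → a t = a t₀ ∧ ∀ n k, U t n k ≤ U t n (a t₀ n) := by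
    intro t ht
    induction t, ht using Nat.le_induction with
    | base =>
      refine ⟨rfl, ?_⟩
      cases t₀ with
      | zero => exact hmax
      | succ s => exact step s rfl hmax
    | succ t _ ih =>
      obtain ⟨ha, hU⟩ := ih
      have ha' : a (t + 1) = a t₀ := by
        rw [← ha]
        funext n
        exact htie t n fun k => by simpa only [ha] using hU n k
      exact ⟨ha', step t ha' hU⟩
  exact fun t ht => (invariant t ht.le).1
end

section
/- Consider a finite normal-form game with players n = 1,…,N, finite strategy sets A_n, and utilities u_n, with Modified Fictitious Play dynamics with constant step 0 < α ≤ 1: Ū_{n,k}(t) = (1−α)·Ū_{n,k}(t−1) + α·u_n(k, a_{-n}(t)) for all k ∈ A_n, and a_n(t+1) maximizes k ↦ Ū_{n,k}(t). Suppose that for every n and k, Ū_{n,k}(t) converges as t → ∞ to a limit L_{n,k}. Then u_n(k, a_{-n}(t)) → L_{n,k} for every n and k; moreover, if for each n the vector (L_{n,k})_{k ∈ A_n} has a unique maximizer k_n*, then there exists t_1 such that a(t) = (k_1*,…,k_N*) for all t > t_1, and the profile (k_1*,…,k_N*) is a pure Nash equilibrium of the game. -/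
open Filter

/-- Modified Fictitious Play with constant step `α`: if every fictitious utility
`Ū t n k` converges to `L n k`, then the deviation utilities `u n (k, a₋ₙ(t))` converge
to `L n k` as well; moreover, if each `L n ·` has a unique maximizer `k* n`, then the
play is eventually constantly equal to `k*`, and `k*` is a pure Nash equilibrium. -/
theorem stmt19
    {N : ℕ} (A : Fin N → Type) [∀ n, Fintype (A n)] [∀ n, Nonempty (A n)]
    (u : (n : Fin N) → ((m : Fin N) → A m) → ℝ)
    (α : ℝ) (hα0 : 0 < α) (hα1 : α ≤ 1)
    (a : ℕ → (m : Fin N) → A m) (U : ℕ → (n : Fin N) → A n → ℝ)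
    (hupdate : ∀ (t : ℕ) (n : Fin N) (k : A n),
      U (t + 1) n k = (1 - α) * U t n k + α * u n (Function.update (a (t + 1)) n k))
    (hbr : ∀ (t : ℕ) (n : Fin N) (k : A n), U t n k ≤ U t n (a (t + 1) n))
    (L : (n : Fin N) → A n → ℝ)
    (hL : ∀ (n : Fin N) (k : A n), Tendsto (fun t => U t n k) atTop (nhds (L n k))) :
    (∀ (n : Fin N) (k : A n),
      Tendsto (fun t => u n (Function.update (a t) n k)) atTop (nhds (L n k))) ∧
    (∀ kstar : (m : Fin N) → A m,
      (∀ (n : Fin N) (k : A n), k ≠ kstar n → L n k < L n (kstar n)) →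
      (∃ t₁ : ℕ, ∀ t : ℕ, t₁ < t → a t = kstar) ∧
      (∀ (n : Fin N) (k : A n), u n (Function.update kstar n k) ≤ u n kstar)) := by
  have hlim : ∀ (n : Fin N) (k : A n),
      Tendsto (fun t => u n (Function.update (a t) n k)) atTop (nhds (L n k)) := by
    intro n k
    rw [← tendsto_add_atTop_iff_nat 1]
    have h := ((((tendsto_add_atTop_iff_nat 1).2 (hL n k)).sub
      ((hL n k).const_mul (1 - α))).div_const α)
    convert h using 1
    · funext t
      rw [hupdate t n k]
      field_simp
      ring
    · congr 1
      field_simp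
      ring
  refine ⟨hlim, fun kstar hk => ?_⟩
  have hev : ∀ᶠ t in atTop, ∀ (n : Fin N) (k : A n), k ≠ kstar n → U t n k < U t n (kstar n) := by
    simp only [eventually_all]
    exact fun n k hne => (hL n k).eventually_lt (hL n (kstar n)) (hk n k hne)
  obtain ⟨t₁, ht₁⟩ := eventually_atTop.1 hev
  have hplay : ∀ t : ℕ, t₁ < t → a t = kstar := by
    rintro (_ | t) ht
    · omega
    · funext n
      by_contra hne
      exact (hbr t n (kstar n)).not_gt (ht₁ t (by omega) n _ hne)
  refine ⟨⟨t₁, hplay⟩, fun n k => ?_⟩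
  have hval : ∀ k : A n, u n (Function.update kstar n k) = L n k := fun k =>
    tendsto_nhds_unique (tendsto_const_nhds.congr' <| by
      filter_upwards [eventually_gt_atTop t₁] with t ht
      rw [hplay t ht]) (hlim n k)
  have hself := hval (kstar n)
  rw [Function.update_eq_self] at hself
  rw [hval, hself]
  rcases eq_or_ne k (kstar n) with rfl | hne
  · exact le_rfl
  · exact (hk n k hne).le
end
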